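/- (Lyndon–Schützenberger) In a free group, if x² y² z² = 1 then x, y, z pairwise commute. -/

import Mathlib

/-- The character of the dihedral group of order 8 which is nontrivial on the reflection `sr 0`
and trivial on `sr 1`. -/
def dihedralCharZero : DihedralGroup 4 →* Multiplicative (ZMod 2) where
  toFun
    | .r k => .ofAdd (ZMod.castHom (show 2 ∣ 4 by decide) (ZMod 2) k)
    | .sr k => .ofAdd (ZMod.castHom (show 2 ∣ 4 by decide) (ZMod 2) k + 1)
  map_one' := by decide
  map_mul' := by decide

/-- The character of the dihedral group of order 8 which is trivial on the reflection `sr 0`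
and nontrivial on `sr 1`. -/
def dihedralCharOne : DihedralGroup 4 →* Multiplicative (ZMod 2) where
  toFun
    | .r k => .ofAdd (ZMod.castHom (show 2 ∣ 4 by decide) (ZMod 2) k)
    | .sr k => .ofAdd (ZMod.castHom (show 2 ∣ 4 by decide) (ZMod 2) k)
  map_one' := by decide
  map_mul' := by decide

/-- The two characters have isotropic, hence linearly dependent, value vectors on a solution of
`p² q² r² = 1` lying in their kernels. -/
theorem dihedralChar_dependent : ∀ p q r : DihedralGroup 4, p ^ 2 * q ^ 2 * r ^ 2 = 1 →
    dihedralCharZero p * dihedralCharZero q * dihedralCharZero r = 1 →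
    dihedralCharOne p * dihedralCharOne q * dihedralCharOne r = 1 →
    (dihedralCharZero p = 1 ∧ dihedralCharZero q = 1 ∧ dihedralCharZero r = 1) ∨
    (dihedralCharOne p = 1 ∧ dihedralCharOne q = 1 ∧ dihedralCharOne r = 1) ∨
    (dihedralCharZero p = dihedralCharOne p ∧ dihedralCharZero q = dihedralCharOne q ∧
      dihedralCharZero r = dihedralCharOne r) := by
  decide +kernel

namespace FreeGroup

variable {ι : Type*} {x y z : FreeGroup ι}

theorem map_mul_mul_eq_one_of_sq_mul_sq_mul_sq (h : x ^ 2 * y ^ 2 * z ^ 2 = 1)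
    (χ : FreeGroup ι →* Multiplicative (ZMod 2)) : χ x * χ y * χ z = 1 := by
  let red : Multiplicative (ZMod 4) →* Multiplicative (ZMod 2) :=
    AddMonoidHom.toMultiplicative (ZMod.castHom (show 2 ∣ 4 by decide) (ZMod 2)).toAddMonoidHom
  have hred : Function.Surjective red := by decide
  let χ' := lift fun i => Function.surjInv hred (χ (of i))
  have hχ : red.comp χ' = χ := by
    ext1 i
    simp [χ', Function.surjInv_eq]
  have key : ∀ p q r : Multiplicative (ZMod 4), p ^ 2 * q ^ 2 * r ^ 2 = 1 →
      red p * red q * red r = 1 := by decide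
  rw [← hχ]
  exact key _ _ _ (by simpa using congrArg χ' h)

theorem subsingleton_of_sq_mul_sq_mul_sq (h : x ^ 2 * y ^ 2 * z ^ 2 = 1)
    (hgen : Subgroup.closure {x, y, z} = ⊤) : Subsingleton ι := by
  classical
  refine ⟨fun a b => by_contra fun hab => ?_⟩
  let f : FreeGroup ι →* DihedralGroup 4 :=
    lift fun i => if i = a then .sr 0 else if i = b then .sr 1 else 1
  have ha : f (of a) = .sr 0 := by simp [f]
  have hb : f (of b) = .sr 1 := by simp [f, Ne.symm hab]
  have eq_of_eq {χ ψ : FreeGroup ι →* Multiplicative (ZMod 2)}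
      (hxyz : χ x = ψ x ∧ χ y = ψ y ∧ χ z = ψ z) : χ = ψ :=
    MonoidHom.eq_of_eqOn_dense hgen (by simpa [Set.EqOn] using hxyz)
  rcases dihedralChar_dependent (f x) (f y) (f z) (by simpa using congrArg f h)
    (map_mul_mul_eq_one_of_sq_mul_sq_mul_sq h (dihedralCharZero.comp f))
    (map_mul_mul_eq_one_of_sq_mul_sq_mul_sq h (dihedralCharOne.comp f)) with h0 | h1 | h01
  · have := DFunLike.congr_fun (eq_of_eq (χ := dihedralCharZero.comp f) (ψ := 1) h0) (of a)
    rw [MonoidHom.comp_apply, ha, MonoidHom.one_apply] at this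
    exact absurd this (by decide)
  · have := DFunLike.congr_fun (eq_of_eq (χ := dihedralCharOne.comp f) (ψ := 1) h1) (of b)
    rw [MonoidHom.comp_apply, hb, MonoidHom.one_apply] at this
    exact absurd this (by decide)
  · have := DFunLike.congr_fun
      (eq_of_eq (χ := dihedralCharZero.comp f) (ψ := dihedralCharOne.comp f) h01) (of a)
    rw [MonoidHom.comp_apply, MonoidHom.comp_apply, ha] at this
    exact absurd this (by decide)

theorem commute_of_subsingleton [Subsingleton ι] (u v : FreeGroup ι) : Commute u v := by
  cases isEmpty_or_nonempty ι
  · exact Subsingleton.elim _ _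
  · have := Classical.choice (nonempty_unique ι)
    exact mulEquivIntOfUnique.injective (by rw [_root_.map_mul, _root_.map_mul, mul_comm])

end FreeGroup

theorem IsFreeGroup.commute_of_sq_mul_sq_mul_sq {G : Type*} [Group G] [IsFreeGroup G] {x y z : G}
    (h : x ^ 2 * y ^ 2 * z ^ 2 = 1) (hgen : Subgroup.closure {x, y, z} = ⊤) (u v : G) :
    Commute u v := by
  let e := IsFreeGroup.mulEquiv G
  have : Subsingleton (IsFreeGroup.Generators G) :=
    FreeGroup.subsingleton_of_sq_mul_sq_mul_sq (x := e.symm x) (y := e.symm y) (z := e.symm z)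
      (by simpa using congrArg e.symm h) (by
        have := congrArg (Subgroup.map e.symm.toMonoidHom) hgen
        rw [MonoidHom.map_closure, Subgroup.map_top_of_surjective _ e.symm.surjective] at this
        simpa [Set.image_insert_eq] using this)
  exact e.symm.injective (by simpa using (FreeGroup.commute_of_subsingleton _ _).eq)

theorem lyndon_schutzenberger {S : Type*} (x y z : FreeGroup S)
    (h : x ^ 2 * y ^ 2 * z ^ 2 = 1) :
    x * y = y * x ∧ y * z = z * y ∧ x * z = z * x := by
  let H := Subgroup.closure {x, y, z}
  have hsub : ({x, y, z} : Set (FreeGroup S)) ⊆ H := Subgroup.subset_closure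
  let x' : H := ⟨x, hsub (by simp)⟩
  let y' : H := ⟨y, hsub (by simp)⟩
  let z' : H := ⟨z, hsub (by simp)⟩
  have hgen : Subgroup.closure {x', y', z'} = ⊤ := by
    rw [← Subgroup.closure_closure_coe_preimage (k := {x, y, z})]
    congr 1
    ext w
    simp [x', y', z', Subtype.ext_iff]
  have comm := IsFreeGroup.commute_of_sq_mul_sq_mul_sq
    (Subtype.ext h : x' ^ 2 * y' ^ 2 * z' ^ 2 = 1) hgen
  exact ⟨congrArg Subtype.val (comm x' y'), congrArg Subtype.val (comm y' z'),
    congrArg Subtype.val (comm x' z')⟩
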